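/- Assume c > 0 and A_{i,j} ≥ κ hᵢ for all i, j, with κ > 0. Let u ∈ W̃_β^{p+1,∞} be an exact solution of −(βu′)′ + γu′ + cu = f on (a,α) ∪ (α,b) with u(a) = u(b) = 0, and let u_T ∈ U_T be an IFVM solution with the same data f. Then there exist constants h₀ > 0 and C > 0, depending only on p, β⁻, β⁺, γ, c, κ and b−a, such that whenever h ≤ h₀, the optimal-order H¹ error estimate |u − u_T|₁ ≤ C h^p ‖u‖_{p+1,∞} holds, where |v|²₁ = ∫_a^b v′(x)² dx. -/

import Mathlib

open Set

/-- The piecewise-constant diffusion coefficient with interface point `α`. -/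
noncomputable def betaPW (βm βp α : ℝ) : ℝ → ℝ := fun t => if t < α then βm else βp

/-- Membership in the immersed trial space `U_T`: continuous on `[a,b]`, zero boundary
values, a polynomial of degree ≤ p on each non-interface element `[x_{i-1}, x_i]` (i ≠ k),
and on the interface element `[x_{k-1}, x_k]` a continuous piecewise polynomial of degree ≤ p
satisfying the derivative jump conditions at the interface `α`. -/
def MemUT (p N k : ℕ) (a b α βm βp : ℝ) (x : ℕ → ℝ) (v : ℝ → ℝ) : Prop :=
  ContinuousOn v (Set.Icc a b) ∧ v a = 0 ∧ v b = 0 ∧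
  (∀ i, 1 ≤ i → i ≤ N → i ≠ k → ∃ q : Polynomial ℝ, q.natDegree ≤ p ∧
    ∀ y ∈ Set.Icc (x (i - 1)) (x i), v y = q.eval y) ∧
  ∃ qm qp : Polynomial ℝ, qm.natDegree ≤ p ∧ qp.natDegree ≤ p ∧
    (∀ y ∈ Set.Icc (x (k - 1)) α, v y = qm.eval y) ∧
    (∀ y ∈ Set.Icc α (x k), v y = qp.eval y) ∧
    ∀ j, 1 ≤ j → j ≤ p →
      βm * ((⇑Polynomial.derivative)^[j] qm).eval α
        = βp * ((⇑Polynomial.derivative)^[j] qp).eval α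

/-- Membership in `W̃_β^{m,∞}`: continuous on `[a,b]`, zero boundary values, `C^m` on each
of `[a,α]` and `[α,b]`, and satisfying the flux jump conditions at `α` for `j = 1,…,m`. -/
def MemW (m : ℕ) (a b α βm βp : ℝ) (u : ℝ → ℝ) : Prop :=
  ContinuousOn u (Set.Icc a b) ∧ u a = 0 ∧ u b = 0 ∧
  ContDiffOn ℝ (m : ℕ∞) u (Set.Icc a α) ∧ ContDiffOn ℝ (m : ℕ∞) u (Set.Icc α b) ∧
  ∀ j, 1 ≤ j → j ≤ m →
    βm * iteratedDerivWithin j u (Set.Icc a α) α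
      = βp * iteratedDerivWithin j u (Set.Icc α b) α

/-- The broken `W^{m,∞}` norm `‖u‖_{m,∞}`: maximum of the piecewise `W^{m,∞}` norms on
`[a,α]` and `[α,b]`. -/
noncomputable def wnorm (m : ℕ) (a b α : ℝ) (u : ℝ → ℝ) : ℝ :=
  max (sSup {y : ℝ | ∃ j ≤ m, ∃ t ∈ Set.Icc a α,
        y = |iteratedDerivWithin j u (Set.Icc a α) t|})
      (sSup {y : ℝ | ∃ j ≤ m, ∃ t ∈ Set.Icc α b,
        y = |iteratedDerivWithin j u (Set.Icc α b) t|})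

open MeasureTheory

/-- Cauchy–Schwarz for an integral over a bounded interval. -/
theorem sq_intervalIntegral_le {v : ℝ → ℝ} {y z : ℝ} (hyz : y ≤ z)
    (hv : IntervalIntegrable v volume y z)
    (hv2 : IntervalIntegrable (fun t => v t ^ 2) volume y z) :
    (∫ t in y..z, v t) ^ 2 ≤ (z - y) * ∫ t in y..z, v t ^ 2 := by
  rcases hyz.eq_or_lt with rfl | hlt
  · simp
  have hpos : 0 < z - y := sub_pos.2 hlt
  set I := ∫ t in y..z, v t with hI
  have h0 : 0 ≤ ∫ t in y..z, ((z - y) * v t - I) ^ 2 :=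
    intervalIntegral.integral_nonneg hyz fun t _ => sq_nonneg _
  have h1 : ∫ t in y..z, ((z - y) * v t - I) ^ 2
      = (z - y) ^ 2 * (∫ t in y..z, v t ^ 2) - 2 * (z - y) * I * I + I ^ 2 * (z - y) := by
    have : (fun t => ((z - y) * v t - I) ^ 2)
        = fun t => ((z - y) ^ 2 * v t ^ 2 - 2 * (z - y) * I * v t) + I ^ 2 := by
      funext t; ring
    rw [this, intervalIntegral.integral_add ((hv2.const_mul _).sub (hv.const_mul _)) (by simp),
      intervalIntegral.integral_sub (hv2.const_mul _) (hv.const_mul _),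
      intervalIntegral.integral_const_mul, intervalIntegral.integral_const_mul,
      intervalIntegral.integral_const]
    simp only [smul_eq_mul]
    ring
  rw [h1] at h0
  have h2 : 0 ≤ (z - y) * ((z - y) * (∫ t in y..z, v t ^ 2) - I ^ 2) := by
    linarith
  have := nonneg_of_mul_nonneg_right h2 hpos
  linarith

theorem IntervalIntegrable.mono_Icc {v : ℝ → ℝ} {a b y z : ℝ}
    (hv : IntervalIntegrable v volume a b) (hy : y ∈ Icc a b) (hz : z ∈ Icc a b) :
    IntervalIntegrable v volume y z :=
  hv.mono_set (uIcc_subset_uIcc (Icc_subset_uIcc hy) (Icc_subset_uIcc hz))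

section Energy

variable {a b γ c : ℝ} {e v : ℝ → ℝ} {P : Set ℝ}

theorem sub_eq_integral_of_hasDerivAt_off_countable (hP : P.Countable)
    (he : ContinuousOn e (Icc a b)) (hd : ∀ t ∈ Ioo a b \ P, HasDerivAt e (v t) t)
    (hv : IntervalIntegrable v volume a b) {y z : ℝ} (hy : y ∈ Icc a b) (hz : z ∈ Icc a b) :
    ∫ t in y..z, v t = e z - e y := by
  have key : ∀ y z : ℝ, y ∈ Icc a b → z ∈ Icc a b → y ≤ z →
      ∫ t in y..z, v t = e z - e y := fun y z hy hz hyz =>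
    integral_eq_of_hasDerivAt_off_countable_of_le e v hyz hP
      (he.mono (Icc_subset_Icc hy.1 hz.2))
      (fun t ht => hd t ⟨⟨hy.1.trans_lt ht.1.1, ht.1.2.trans_le hz.2⟩, ht.2⟩)
      (hv.mono_Icc hy hz)
  rcases le_total y z with h | h
  · exact key y z hy hz h
  · rw [intervalIntegral.integral_symm, key z y hz hy h]; ring

theorem integral_sq_mono {a b y z : ℝ} (hv2 : IntervalIntegrable (fun t => v t ^ 2) volume a b)
    (hay : a ≤ y) (hyz : y ≤ z) (hzb : z ≤ b) :
    ∫ t in y..z, v t ^ 2 ≤ ∫ t in a..b, v t ^ 2 :=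
  intervalIntegral.integral_mono_interval hay hyz hzb
    (Filter.Eventually.of_forall fun t => sq_nonneg (v t)) hv2

theorem sq_le_of_hasDerivAt (hP : P.Countable)
    (he : ContinuousOn e (Icc a b)) (hea : e a = 0)
    (hd : ∀ t ∈ Ioo a b \ P, HasDerivAt e (v t) t)
    (hv : IntervalIntegrable v volume a b)
    (hv2 : IntervalIntegrable (fun t => v t ^ 2) volume a b) {t : ℝ} (ht : t ∈ Icc a b) :
    e t ^ 2 ≤ (b - a) * ∫ t in a..b, v t ^ 2 := by
  have hab := ht.1.trans ht.2
  have haa : a ∈ Icc a b := left_mem_Icc.2 hab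
  have h1 := sub_eq_integral_of_hasDerivAt_off_countable hP he hd hv haa ht
  rw [hea, sub_zero] at h1
  rw [← h1]
  refine (sq_intervalIntegral_le ht.1 (hv.mono_Icc haa ht) (hv2.mono_Icc haa ht)).trans ?_
  refine mul_le_mul (by linarith [ht.2]) (integral_sq_mono hv2 le_rfl ht.1 ht.2)
    (intervalIntegral.integral_nonneg ht.1 fun _ _ => sq_nonneg _) (by linarith)

theorem hasDerivAt_primitive (he : ContinuousOn e (Icc a b)) {t : ℝ} (ht : t ∈ Ioo a b) :
    HasDerivAt (fun t => ∫ s in a..t, e s) (e t) t := by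
  have hab := (ht.1.trans ht.2).le
  refine intervalIntegral.integral_hasDerivAt_right
    ((he.intervalIntegrable_of_Icc (μ := volume) hab).mono_Icc (left_mem_Icc.2 hab) (Ioo_subset_Icc_self ht))
    ((he.mono Ioo_subset_Icc_self).stronglyMeasurableAtFilter isOpen_Ioo t ht)
    (he.continuousAt (Icc_mem_nhds ht.1 ht.2))

theorem continuousOn_primitive_Icc (hab : a ≤ b) (he : ContinuousOn e (Icc a b)) :
    ContinuousOn (fun t => ∫ s in a..t, e s) (Icc a b) := by
  have := intervalIntegral.continuousOn_primitive_interval'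
    (he.intervalIntegrable_of_Icc (μ := volume) hab) left_mem_uIcc
  rwa [uIcc_of_le hab] at this

theorem integral_sq_le_of_forall {D : ℝ} (hab : a ≤ b)
    (he : ContinuousOn e (Icc a b)) (hD : ∀ t ∈ Icc a b, e t ^ 2 ≤ D) :
    ∫ t in a..b, e t ^ 2 ≤ (b - a) * D := by
  have he2 : IntervalIntegrable (fun t => e t ^ 2) volume a b :=
    (he.pow 2).intervalIntegrable_of_Icc hab
  have := intervalIntegral.integral_mono_on hab he2 (intervalIntegrable_const (c := D)) hD
  simpa using this

theorem primitive_sq_le {D : ℝ} (he : ContinuousOn e (Icc a b))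
    (hD : ∀ t ∈ Icc a b, e t ^ 2 ≤ D) {t : ℝ} (ht : t ∈ Icc a b) :
    (∫ s in a..t, e s) ^ 2 ≤ (b - a) ^ 2 * D := by
  have hab := ht.1.trans ht.2
  have het := he.mono (Icc_subset_Icc_right ht.2)
  have hD0 : 0 ≤ D := (sq_nonneg _).trans (hD t ht)
  have he1 : IntervalIntegrable e volume a t := het.intervalIntegrable_of_Icc ht.1
  have he2 : IntervalIntegrable (fun s => e s ^ 2) volume a t :=
    (het.pow 2).intervalIntegrable_of_Icc ht.1
  refine (sq_intervalIntegral_le ht.1 he1 he2).trans ?_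
  have h1 := integral_sq_le_of_forall (e := e) ht.1 het fun s hs => hD s ⟨hs.1, hs.2.trans ht.2⟩
  have h2 : t - a ≤ b - a := by linarith [ht.2]
  have h3 : 0 ≤ t - a := by linarith [ht.1]
  calc (t - a) * ∫ s in a..t, e s ^ 2 ≤ (t - a) * ((t - a) * D) := by gcongr
    _ = (t - a) ^ 2 * D := by ring
    _ ≤ (b - a) ^ 2 * D := by gcongr

/-- The convection–reaction flux `γ e + c ∫ e` is a primitive of `γ e' + c e`. -/
theorem flux_sub_eq_integral (hP : P.Countable) (he : ContinuousOn e (Icc a b))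
    (hd : ∀ t ∈ Ioo a b \ P, HasDerivAt e (v t) t)
    (hv : IntervalIntegrable v volume a b) {y z : ℝ} (hy : y ∈ Icc a b) (hz : z ∈ Icc a b) :
    ∫ t in y..z, (γ * v t + c * e t)
      = (γ * e z + c * ∫ s in a..z, e s) - (γ * e y + c * ∫ s in a..y, e s) := by
  have hab := hy.1.trans hy.2
  refine sub_eq_integral_of_hasDerivAt_off_countable
    (e := fun t => γ * e t + c * ∫ s in a..t, e s) hP
    ((he.const_mul _).add ((continuousOn_primitive_Icc hab he).const_mul _)) ?_
    ((hv.const_mul _).add ((he.intervalIntegrable_of_Icc hab).const_mul _)) hy hz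
  intro t ht
  exact ((hd t ht).const_mul _).add ((hasDerivAt_primitive he ht.1).const_mul _)

theorem intervalIntegrable_flux_sq (hab : a ≤ b) (he : ContinuousOn e (Icc a b))
    (hv : IntervalIntegrable v volume a b)
    (hv2 : IntervalIntegrable (fun t => v t ^ 2) volume a b) :
    IntervalIntegrable (fun t => (γ * v t + c * e t) ^ 2) volume a b := by
  have h : (fun t => (γ * v t + c * e t) ^ 2)
      = fun t => γ ^ 2 * v t ^ 2 + 2 * γ * c * (v t * e t) + c ^ 2 * e t ^ 2 := by
    funext t; ring
  rw [h]
  exact ((hv2.const_mul _).add ((hv.mul_continuousOn (by rwa [uIcc_of_le hab])).const_mul _)).add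
    (((he.pow 2).intervalIntegrable_of_Icc hab).const_mul _)

theorem integral_flux_sq_le (hab : a ≤ b) (he : ContinuousOn e (Icc a b))
    (hv : IntervalIntegrable v volume a b)
    (hv2 : IntervalIntegrable (fun t => v t ^ 2) volume a b) {D : ℝ}
    (hD : ∀ t ∈ Icc a b, e t ^ 2 ≤ D) :
    ∫ t in a..b, (γ * v t + c * e t) ^ 2
      ≤ 2 * γ ^ 2 * (∫ t in a..b, v t ^ 2) + 2 * c ^ 2 * ((b - a) * D) := by
  have he2 : IntervalIntegrable (fun t => e t ^ 2) volume a b :=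
    (he.pow 2).intervalIntegrable_of_Icc hab
  have h := intervalIntegral.integral_mono_on hab
    (intervalIntegrable_flux_sq (γ := γ) (c := c) hab he hv hv2)
    ((hv2.const_mul (2 * γ ^ 2)).add (he2.const_mul (2 * c ^ 2)))
    (fun t _ => by nlinarith [sq_nonneg (γ * v t - c * e t)])
  rw [intervalIntegral.integral_add (hv2.const_mul _) (he2.const_mul _),
    intervalIntegral.integral_const_mul, intervalIntegral.integral_const_mul] at h
  refine h.trans ?_
  have := integral_sq_le_of_forall hab he hD
  have hc2 : 0 ≤ 2 * c ^ 2 := by positivity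
  linarith [mul_le_mul_of_nonneg_left this hc2]

/-- Coercivity: testing the flux against `e'` produces only `-c ∫ e²`. -/
theorem integral_deriv_mul_flux_nonpos (hab : a ≤ b) (hc : 0 ≤ c) (hP : P.Countable)
    (he : ContinuousOn e (Icc a b)) (hea : e a = 0) (heb : e b = 0)
    (hd : ∀ t ∈ Ioo a b \ P, HasDerivAt e (v t) t)
    (hv : IntervalIntegrable v volume a b) (K : ℝ) :
    ∫ t in a..b, v t * (γ * e t + c * (∫ s in a..t, e s) + K) ≤ 0 := by
  have hE := continuousOn_primitive_Icc hab he
  have he2 : IntervalIntegrable (fun t => e t ^ 2) volume a b :=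
    (he.pow 2).intervalIntegrable_of_Icc hab
  have hφ : ContinuousOn (fun t => γ * e t + c * (∫ s in a..t, e s) + K) (Icc a b) :=
    ((he.const_mul _).add (hE.const_mul _)).add continuousOn_const
  have hvφ := hv.mul_continuousOn (by rwa [uIcc_of_le hab])
  have h := sub_eq_integral_of_hasDerivAt_off_countable
    (e := fun t => γ / 2 * e t ^ 2 + c * ((∫ s in a..t, e s) * e t) + K * e t)
    (v := fun t => v t * (γ * e t + c * (∫ s in a..t, e s) + K) + c * e t ^ 2) hP
    ((((he.pow 2).const_mul _).add ((hE.mul he).const_mul _)).add (he.const_mul _))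
    (fun t ht => by
      have h1 := hd t ht
      have h2 := hasDerivAt_primitive he ht.1
      have := (((h1.pow 2).const_mul (γ / 2)).add ((h2.mul h1).const_mul c)).add (h1.const_mul K)
      refine this.congr_deriv ?_
      simp
      ring)
    (hvφ.add (he2.const_mul c)) (left_mem_Icc.2 hab) (right_mem_Icc.2 hab)
  rw [intervalIntegral.integral_add hvφ (he2.const_mul c),
    intervalIntegral.integral_const_mul] at h
  simp only [hea, heb] at h
  have h0 : 0 ≤ c * ∫ t in a..b, e t ^ 2 :=
    mul_nonneg hc (intervalIntegral.integral_nonneg hab fun _ _ => sq_nonneg _)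
  simp at h
  linarith

end Energy

section Element

variable {p : ℕ} {y z w₁ ε : ℝ} {w ψ : ℝ → ℝ} {g A : ℕ → ℝ} {s : Polynomial ℝ}

theorem sum_weights_eq
    (hquad : ∀ F : Polynomial ℝ, F.natDegree ≤ 2 * p - 1 →
      ∑ j ∈ Finset.Icc 1 p, A j * F.eval (g j) = ∫ t in y..z, w t * F.eval t) :
    ∑ j ∈ Finset.Icc 1 p, A j = ∫ t in y..z, w t := by
  simpa using hquad 1 (by simp)

theorem sum_weights_mul_eq
    (hquad : ∀ F : Polynomial ℝ, F.natDegree ≤ 2 * p - 1 →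
      ∑ j ∈ Finset.Icc 1 p, A j * F.eval (g j) = ∫ t in y..z, w t * F.eval t)
    (hs : s.natDegree ≤ p - 1) :
    ∑ j ∈ Finset.Icc 1 p, A j * s.eval (g j) = ∫ t in y..z, w t * s.eval t :=
  hquad s (by omega)

theorem sum_weights_mul_sq_eq
    (hquad : ∀ F : Polynomial ℝ, F.natDegree ≤ 2 * p - 1 →
      ∑ j ∈ Finset.Icc 1 p, A j * F.eval (g j) = ∫ t in y..z, w t * F.eval t)
    (hs : s.natDegree ≤ p - 1) :
    ∑ j ∈ Finset.Icc 1 p, A j * s.eval (g j) ^ 2 = ∫ t in y..z, w t * s.eval t ^ 2 := by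
  simpa using hquad (s ^ 2) (Polynomial.natDegree_pow_le.trans (by omega))

theorem intervalIntegral_weight_le (hyz : y ≤ z) (hw : IntervalIntegrable w volume y z)
    (hw₁ : ∀ t, w t ≤ w₁) : ∫ t in y..z, w t ≤ w₁ * (z - y) := by
  have := intervalIntegral.integral_mono_on hyz hw (intervalIntegrable_const (c := w₁))
    fun t _ => hw₁ t
  simpa [mul_comm] using this

/-- Elementwise energy estimate for a polynomial which agrees at the quadrature nodes, up to `ε`,
with a function `ψ` of small oscillation. -/
theorem element_energy_le {hm Φ : ℝ} (hyz : y ≤ z) (hlen : z - y ≤ hm) (hm0 : 0 < hm)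
    (hw : IntervalIntegrable w volume y z) (hw0 : ∀ t, 0 ≤ w t) (hw₁ : ∀ t, w t ≤ w₁)
    (hg : ∀ j ∈ Finset.Icc 1 p, g j ∈ Icc y z) (hA : ∀ j ∈ Finset.Icc 1 p, 0 ≤ A j)
    (hquad : ∀ F : Polynomial ℝ, F.natDegree ≤ 2 * p - 1 →
      ∑ j ∈ Finset.Icc 1 p, A j * F.eval (g j) = ∫ t in y..z, w t * F.eval t)
    (hs : s.natDegree ≤ p - 1) (hψ : ContinuousOn ψ (Icc y z)) (hΦ : 0 ≤ Φ)
    (hosc : ∀ t ∈ Icc y z, (ψ t - ψ y) ^ 2 ≤ hm * Φ)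
    (hnode : ∀ j ∈ Finset.Icc 1 p, (s.eval (g j) - ψ (g j)) ^ 2 ≤ ε ^ 2) :
    ∫ t in y..z, w t * s.eval t ^ 2
      ≤ (∫ t in y..z, w t * s.eval t ^ 2) / 4 + ε ^ 2 * (w₁ * (z - y))
        + (∫ t in y..z, w t * (s.eval t * ψ t))
        + hm * ((∫ t in y..z, w t * s.eval t ^ 2) + w₁ * Φ) := by
  have hsc : ContinuousOn (fun t => s.eval t) (uIcc y z) := s.continuous.continuousOn
  have hψ' : ContinuousOn ψ (uIcc y z) := by rwa [uIcc_of_le hyz]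
  have i1 := hw.mul_continuousOn hsc
  have i2 : IntervalIntegrable (fun t => w t * s.eval t ^ 2) volume y z :=
    hw.mul_continuousOn (hsc.pow 2)
  have i3 : IntervalIntegrable (fun t => w t * (s.eval t * ψ t)) volume y z :=
    hw.mul_continuousOn (hsc.mul hψ')
  have hosc' : ∀ t ∈ Icc y z, ∀ r : ℝ, |r * (ψ t - ψ y)| ≤ hm / 2 * r ^ 2 + Φ / 2 := by
    intro t ht r
    have h1 := hosc t ht
    have hx : ∀ x : ℝ, x ^ 2 ≤ hm * Φ → r * x ≤ hm / 2 * r ^ 2 + Φ / 2 := by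
      intro x hx
      have h2 : 0 ≤ hm * (hm / 2 * r ^ 2 + Φ / 2 - r * x) := by
        nlinarith [sq_nonneg (hm * r - x)]
      linarith [nonneg_of_mul_nonneg_right h2 hm0]
    rw [abs_le]
    have h3 := hx _ h1
    have h4 := hx (-(ψ t - ψ y)) (by rw [neg_sq]; exact h1)
    constructor <;> linarith
  have hW : ∫ t in y..z, w t ≤ w₁ * (z - y) := intervalIntegral_weight_le hyz hw hw₁
  have hw₁0 : 0 ≤ w₁ := (hw0 0).trans (hw₁ 0)
  have hW' : ∫ t in y..z, w t ≤ w₁ * hm := hW.trans (by gcongr)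
  have hsum : ∑ j ∈ Finset.Icc 1 p, A j * s.eval (g j) ^ 2
      ≤ ∑ j ∈ Finset.Icc 1 p, ((1 / 4 + hm / 2) * (A j * s.eval (g j) ^ 2)
        + (ε ^ 2 + Φ / 2) * A j + ψ y * (A j * s.eval (g j))) := by
    refine Finset.sum_le_sum fun j hj => ?_
    have h1 := (abs_le.1 (hosc' _ (hg j hj) (s.eval (g j)))).2
    have h2 := hnode j hj
    have h3 : s.eval (g j) ^ 2 ≤ (1 / 4 + hm / 2) * s.eval (g j) ^ 2 + (ε ^ 2 + Φ / 2)
        + ψ y * s.eval (g j) := by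
      nlinarith [sq_nonneg (s.eval (g j) / 2 - (s.eval (g j) - ψ (g j)))]
    have := mul_le_mul_of_nonneg_left h3 (hA j hj)
    linarith
  rw [Finset.sum_add_distrib, Finset.sum_add_distrib, ← Finset.mul_sum, ← Finset.mul_sum,
    ← Finset.mul_sum, sum_weights_eq hquad, sum_weights_mul_eq hquad hs,
    sum_weights_mul_sq_eq hquad hs] at hsum
  have hint := intervalIntegral.integral_mono_on hyz (i1.const_mul (ψ y))
    ((i3.add (i2.const_mul (hm / 2))).add (hw.const_mul (Φ / 2)))
    (fun t ht => by
      have h1 := (abs_le.1 (hosc' t ht (s.eval t))).1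
      have := mul_le_mul_of_nonneg_left h1 (hw0 t)
      linarith)
  rw [intervalIntegral.integral_const_mul,
    intervalIntegral.integral_add (i3.add (i2.const_mul _)) (hw.const_mul _),
    intervalIntegral.integral_add i3 (i2.const_mul _), intervalIntegral.integral_const_mul,
    intervalIntegral.integral_const_mul] at hint
  have h5 := mul_le_mul_of_nonneg_left hW (sq_nonneg ε)
  have h6 := mul_le_mul_of_nonneg_left hW' hΦ
  linarith

/-- Elementwise bound for the constant `K` by which nodal values of `s` and `φ` differ. -/
theorem element_const_le {φ : ℝ → ℝ} {K B : ℝ} (hyz : y ≤ z)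
    (hw : IntervalIntegrable w volume y z) (hw₁ : ∀ t, w t ≤ w₁)
    (hA : ∀ j ∈ Finset.Icc 1 p, 0 ≤ A j)
    (hquad : ∀ F : Polynomial ℝ, F.natDegree ≤ 2 * p - 1 →
      ∑ j ∈ Finset.Icc 1 p, A j * F.eval (g j) = ∫ t in y..z, w t * F.eval t)
    (hs : s.natDegree ≤ p - 1) (hB0 : 0 ≤ B)
    (hB : ∀ j ∈ Finset.Icc 1 p, φ (g j) ^ 2 ≤ B)
    (hnode : ∀ j ∈ Finset.Icc 1 p, (s.eval (g j) - (φ (g j) + K)) ^ 2 ≤ ε ^ 2) :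
    K ^ 2 * ∫ t in y..z, w t
      ≤ 3 * ((∫ t in y..z, w t * s.eval t ^ 2) + (B + ε ^ 2) * (w₁ * (z - y))) := by
  have hW : ∫ t in y..z, w t ≤ w₁ * (z - y) := intervalIntegral_weight_le hyz hw hw₁
  have hsum : ∑ j ∈ Finset.Icc 1 p, K ^ 2 * A j
      ≤ ∑ j ∈ Finset.Icc 1 p, (3 * (A j * s.eval (g j) ^ 2) + 3 * (B + ε ^ 2) * A j) := by
    refine Finset.sum_le_sum fun j hj => ?_
    have h1 := hB j hj
    have h2 := hnode j hj
    have h3 : K ^ 2 ≤ 3 * s.eval (g j) ^ 2 + 3 * (B + ε ^ 2) := by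
      nlinarith [sq_nonneg (s.eval (g j) + φ (g j)),
        sq_nonneg (s.eval (g j) + (s.eval (g j) - (φ (g j) + K))),
        sq_nonneg (φ (g j) - (s.eval (g j) - (φ (g j) + K)))]
    have := mul_le_mul_of_nonneg_left h3 (hA j hj)
    linarith
  rw [Finset.sum_add_distrib, ← Finset.mul_sum, ← Finset.mul_sum, ← Finset.mul_sum,
    sum_weights_eq hquad, sum_weights_mul_sq_eq hquad hs] at hsum
  have h5 := mul_le_mul_of_nonneg_left hW (by positivity : 0 ≤ B + ε ^ 2)
  linarith

end Element

theorem integral_mono_off_countable {f₁ f₂ : ℝ → ℝ} {y z : ℝ} {P : Set ℝ} (hyz : y ≤ z)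
    (hP : P.Countable) (h₁ : IntervalIntegrable f₁ volume y z)
    (h₂ : IntervalIntegrable f₂ volume y z) (hle : ∀ t ∈ Ioo y z \ P, f₁ t ≤ f₂ t) :
    ∫ t in y..z, f₁ t ≤ ∫ t in y..z, f₂ t := by
  refine intervalIntegral.integral_mono_ae_restrict hyz h₁ h₂ ?_
  rw [← restrict_Ioo_eq_restrict_Icc]
  filter_upwards [ae_restrict_mem measurableSet_Ioo,
    (hP.ae_notMem volume).filter_mono (ae_mono Measure.restrict_le_self)] with t ht hPt
  exact hle t ⟨ht, hPt⟩

/-- A mesh, a weighted quadrature rule, a piecewise smooth error `e` with derivative `v`, and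
piecewise polynomials `s` with `v ≈ w s` which agree at the nodes, up to `ε` and a constant `K`,
with the flux `γ e + c ∫ e`. -/
structure FluxSystem (p N : ℕ) (γ c w₀ w₁ a b hm ε K : ℝ) (x : ℕ → ℝ) (g A : ℕ → ℕ → ℝ)
    (w e v : ℝ → ℝ) (P : Set ℝ) (s : ℕ → Polynomial ℝ) : Prop where
  left : x 0 = a
  right : x N = b
  lt_succ : ∀ i < N, x i < x (i + 1)
  length_le : ∀ i < N, x (i + 1) - x i ≤ hm
  weight_integrable : IntervalIntegrable w volume a b
  le_weight : ∀ t, w₀ ≤ w t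
  weight_le : ∀ t, w t ≤ w₁
  node_mem : ∀ i < N, ∀ j ∈ Finset.Icc 1 p, g i j ∈ Icc (x i) (x (i + 1))
  weights_nonneg : ∀ i < N, ∀ j ∈ Finset.Icc 1 p, 0 ≤ A i j
  quad : ∀ i < N, ∀ F : Polynomial ℝ, F.natDegree ≤ 2 * p - 1 →
    ∑ j ∈ Finset.Icc 1 p, A i j * F.eval (g i j) = ∫ t in (x i)..(x (i + 1)), w t * F.eval t
  continuousOn : ContinuousOn e (Icc a b)
  eq_zero_left : e a = 0
  eq_zero_right : e b = 0
  countable : P.Countable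
  hasDerivAt : ∀ t ∈ Ioo a b \ P, HasDerivAt e (v t) t
  integrable : IntervalIntegrable v volume a b
  integrable_sq : IntervalIntegrable (fun t => v t ^ 2) volume a b
  degree_le : ∀ i < N, (s i).natDegree ≤ p - 1
  approx : ∀ i < N, ∀ t ∈ Ioo (x i) (x (i + 1)) \ P,
    (v t - w t * (s i).eval t) ^ 2 ≤ w₁ ^ 2 * ε ^ 2
  node : ∀ i < N, ∀ j ∈ Finset.Icc 1 p,
    ((s i).eval (g i j) - (γ * e (g i j) + c * (∫ r in a..(g i j), e r) + K)) ^ 2 ≤ ε ^ 2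

theorem mesh_mono {N : ℕ} {x : ℕ → ℝ} (hx : ∀ i < N, x i < x (i + 1)) {i j : ℕ} (hij : i ≤ j)
    (hj : j ≤ N) : x i ≤ x j := by
  induction j, hij using Nat.le_induction with
  | base => exact le_rfl
  | succ n hn ih => exact (ih (by omega)).trans (hx n (by omega)).le

namespace FluxSystem

variable {p N : ℕ} {γ c w₀ w₁ a b hm ε K : ℝ} {x : ℕ → ℝ} {g A : ℕ → ℕ → ℝ}
  {w e v : ℝ → ℝ} {P : Set ℝ} {s : ℕ → Polynomial ℝ}

theorem mesh_mem (H : FluxSystem p N γ c w₀ w₁ a b hm ε K x g A w e v P s) {i : ℕ} (hi : i ≤ N) :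
    x i ∈ Icc a b :=
  ⟨H.left ▸ mesh_mono H.lt_succ (Nat.zero_le i) hi, H.right ▸ mesh_mono H.lt_succ hi le_rfl⟩

theorem le (H : FluxSystem p N γ c w₀ w₁ a b hm ε K x g A w e v P s) : a ≤ b :=
  (H.mesh_mem le_rfl).1.trans (H.mesh_mem le_rfl).2

theorem element_subset (H : FluxSystem p N γ c w₀ w₁ a b hm ε K x g A w e v P s) {i : ℕ}
    (hi : i < N) : Icc (x i) (x (i + 1)) ⊆ Icc a b :=
  Icc_subset_Icc (H.mesh_mem hi.le).1 (H.mesh_mem hi).2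

theorem restrict (H : FluxSystem p N γ c w₀ w₁ a b hm ε K x g A w e v P s) {i : ℕ}
    (hi : i < N) {F : ℝ → ℝ} (hF : IntervalIntegrable F volume a b) :
    IntervalIntegrable F volume (x i) (x (i + 1)) :=
  hF.mono_Icc (H.mesh_mem hi.le) (H.mesh_mem hi)

theorem sum_integral (H : FluxSystem p N γ c w₀ w₁ a b hm ε K x g A w e v P s) {F : ℝ → ℝ}
    (hF : IntervalIntegrable F volume a b) :
    ∑ i ∈ Finset.range N, ∫ t in (x i)..(x (i + 1)), F t = ∫ t in a..b, F t := by
  rw [intervalIntegral.sum_integral_adjacent_intervals fun i hi => H.restrict hi hF,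
    H.left, H.right]

theorem sum_length (H : FluxSystem p N γ c w₀ w₁ a b hm ε K x g A w e v P s) :
    ∑ i ∈ Finset.range N, (x (i + 1) - x i) = b - a := by
  rw [Finset.sum_range_sub, H.left, H.right]

theorem sq_le (H : FluxSystem p N γ c w₀ w₁ a b hm ε K x g A w e v P s) {t : ℝ}
    (ht : t ∈ Icc a b) : e t ^ 2 ≤ (b - a) * ∫ t in a..b, v t ^ 2 :=
  sq_le_of_hasDerivAt H.countable H.continuousOn H.eq_zero_left H.hasDerivAt H.integrable
    H.integrable_sq ht

theorem flux_sq_le (H : FluxSystem p N γ c w₀ w₁ a b hm ε K x g A w e v P s) {t : ℝ}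
    (ht : t ∈ Icc a b) :
    (γ * e t + c * ∫ r in a..t, e r) ^ 2
      ≤ (2 * γ ^ 2 * (b - a) + 2 * c ^ 2 * (b - a) ^ 3) * ∫ t in a..b, v t ^ 2 := by
  have h1 := H.sq_le ht
  have h2 := primitive_sq_le H.continuousOn (fun t ht => H.sq_le ht) ht
  have h3 := mul_le_mul_of_nonneg_left h1 (by positivity : 0 ≤ 2 * γ ^ 2)
  have h4 := mul_le_mul_of_nonneg_left h2 (by positivity : 0 ≤ 2 * c ^ 2)
  nlinarith [sq_nonneg (γ * e t - c * ∫ r in a..t, e r)]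

theorem weight_nonneg (H : FluxSystem p N γ c w₀ w₁ a b hm ε K x g A w e v P s) (hw₀ : 0 < w₀)
    (t : ℝ) : 0 ≤ w t := hw₀.le.trans (H.le_weight t)

theorem integrable_weight_sq (H : FluxSystem p N γ c w₀ w₁ a b hm ε K x g A w e v P s) {i : ℕ}
    (hi : i < N) :
    IntervalIntegrable (fun t => w t * (s i).eval t ^ 2) volume (x i) (x (i + 1)) :=
  (H.restrict hi H.weight_integrable).mul_continuousOn ((s i).continuous.pow 2).continuousOn

theorem integral_deriv_sq_le (H : FluxSystem p N γ c w₀ w₁ a b hm ε K x g A w e v P s)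
    (hw₀ : 0 < w₀) :
    ∫ t in a..b, v t ^ 2
      ≤ 2 * w₁ * (∑ i ∈ Finset.range N, ∫ t in (x i)..(x (i + 1)), w t * (s i).eval t ^ 2)
        + 2 * (w₁ ^ 2 * ε ^ 2) * (b - a) := by
  rw [← H.sum_integral H.integrable_sq, ← H.sum_length, Finset.mul_sum, Finset.mul_sum,
    ← Finset.sum_add_distrib]
  refine Finset.sum_le_sum fun i hi => ?_
  have hi := Finset.mem_range.1 hi
  have i2 := H.integrable_weight_sq hi
  have h := integral_mono_off_countable (H.lt_succ i hi).le H.countable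
    (H.restrict hi H.integrable_sq)
    ((i2.const_mul (2 * w₁)).add (intervalIntegrable_const (c := 2 * (w₁ ^ 2 * ε ^ 2))))
    (fun t ht => by
      have h1 := H.approx i hi t ht
      have h2 : w t * (w t * (s i).eval t ^ 2) ≤ w₁ * (w t * (s i).eval t ^ 2) :=
        mul_le_mul_of_nonneg_right (H.weight_le t)
          (mul_nonneg (H.weight_nonneg hw₀ t) (sq_nonneg _))
      nlinarith [sq_nonneg (v t - 2 * (w t * (s i).eval t))])
  rw [intervalIntegral.integral_add (i2.const_mul _) intervalIntegrable_const,
    intervalIntegral.integral_const_mul, intervalIntegral.integral_const, smul_eq_mul] at h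
  linarith

theorem const_sq_le (H : FluxSystem p N γ c w₀ w₁ a b hm ε K x g A w e v P s) :
    K ^ 2 * (w₀ * (b - a))
      ≤ 3 * ((∑ i ∈ Finset.range N, ∫ t in (x i)..(x (i + 1)), w t * (s i).eval t ^ 2)
        + ((2 * γ ^ 2 * (b - a) + 2 * c ^ 2 * (b - a) ^ 3) * (∫ t in a..b, v t ^ 2) + ε ^ 2)
          * (w₁ * (b - a))) := by
  set B := (2 * γ ^ 2 * (b - a) + 2 * c ^ 2 * (b - a) ^ 3) * (∫ t in a..b, v t ^ 2) with hBdef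
  have hB0 : 0 ≤ B := (sq_nonneg _).trans (H.flux_sq_le (left_mem_Icc.2 H.le))
  have hint : w₀ * (b - a) ≤ ∫ t in a..b, w t := by
    have := intervalIntegral.integral_mono_on H.le (intervalIntegrable_const (c := w₀))
      H.weight_integrable fun t _ => H.le_weight t
    simpa [mul_comm] using this
  refine (mul_le_mul_of_nonneg_left hint (sq_nonneg K)).trans ?_
  rw [← H.sum_integral H.weight_integrable, ← H.sum_length]
  simp only [Finset.mul_sum]
  rw [← Finset.sum_add_distrib, Finset.mul_sum]
  refine Finset.sum_le_sum fun i hi => ?_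
  have hi := Finset.mem_range.1 hi
  exact element_const_le (φ := fun t => γ * e t + c * ∫ r in a..t, e r) (H.lt_succ i hi).le
    (H.restrict hi H.weight_integrable) H.weight_le (H.weights_nonneg i hi) (H.quad i hi)
    (H.degree_le i hi) hB0
    (fun j hj => H.flux_sq_le (H.element_subset hi (H.node_mem i hi j hj))) (H.node i hi)

theorem energy_le (H : FluxSystem p N γ c w₀ w₁ a b hm ε K x g A w e v P s) (hw₀ : 0 < w₀)
    (hc : 0 ≤ c) (hm0 : 0 < hm) {η : ℝ} (hη : 0 < η) {S D : ℝ}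
    (hS : S = ∑ i ∈ Finset.range N, ∫ t in (x i)..(x (i + 1)), w t * (s i).eval t ^ 2)
    (hD : D = ∫ t in a..b, v t ^ 2) :
    S ≤ S / 4 + ε ^ 2 * (w₁ * (b - a))
      + (w₁ ^ 2 * ε ^ 2 / (4 * η)
        + η * (2 * ((2 * γ ^ 2 * (b - a) + 2 * c ^ 2 * (b - a) ^ 3) * D) + 2 * K ^ 2)) * (b - a)
      + hm * (S + w₁ * ((2 * γ ^ 2 + 2 * c ^ 2 * (b - a) ^ 2) * D)) := by
  have hab := H.le
  have hw₁0 : 0 ≤ w₁ := (H.weight_nonneg hw₀ 0).trans (H.weight_le 0)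
  set ψ : ℝ → ℝ := fun t => γ * e t + c * (∫ r in a..t, e r) + K with hψ
  set B := 2 * ((2 * γ ^ 2 * (b - a) + 2 * c ^ 2 * (b - a) ^ 3) * D) + 2 * K ^ 2 with hB
  have hψc : ContinuousOn ψ (Icc a b) :=
    ((H.continuousOn.const_mul _).add
      ((continuousOn_primitive_Icc hab H.continuousOn).const_mul _)).add continuousOn_const
  have hψB : ∀ t ∈ Icc a b, ψ t ^ 2 ≤ B := by
    intro t ht
    have h1 := H.flux_sq_le ht
    rw [← hD] at h1
    simp only [hψ, hB]
    nlinarith [sq_nonneg ((γ * e t + c * ∫ r in a..t, e r) - K)]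
  have hvψ : IntervalIntegrable (fun t => v t * ψ t) volume a b :=
    H.integrable.mul_continuousOn (by rwa [uIcc_of_le hab])
  have hfl : IntervalIntegrable (fun t => (γ * v t + c * e t) ^ 2) volume a b :=
    intervalIntegrable_flux_sq hab H.continuousOn H.integrable H.integrable_sq
  have hel : ∀ i ∈ Finset.range N,
      (∫ t in (x i)..(x (i + 1)), w t * (s i).eval t ^ 2)
      ≤ (1 / 4 + hm) * (∫ t in (x i)..(x (i + 1)), w t * (s i).eval t ^ 2)
        + (ε ^ 2 * w₁ + (w₁ ^ 2 * ε ^ 2 / (4 * η) + η * B)) * (x (i + 1) - x i)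
        + (∫ t in (x i)..(x (i + 1)), v t * ψ t)
        + hm * w₁ * (∫ t in (x i)..(x (i + 1)), (γ * v t + c * e t) ^ 2) := by
    intro i hi
    have hi := Finset.mem_range.1 hi
    have hlt := H.lt_succ i hi
    have hsub := H.element_subset hi
    have hwi := H.restrict hi H.weight_integrable
    have hΦ0 : 0 ≤ ∫ t in (x i)..(x (i + 1)), (γ * v t + c * e t) ^ 2 :=
      intervalIntegral.integral_nonneg hlt.le fun _ _ => sq_nonneg _
    have h1 := element_energy_le (ε := ε) hlt.le (H.length_le i hi) hm0 hwi
      (H.weight_nonneg hw₀) H.weight_le (H.node_mem i hi) (H.weights_nonneg i hi) (H.quad i hi)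
      (H.degree_le i hi) (hψc.mono hsub) hΦ0 (fun t ht => by
        have hxi := H.mesh_mem hi.le
        have hfe := flux_sub_eq_integral (γ := γ) (c := c) H.countable H.continuousOn H.hasDerivAt
          H.integrable hxi (hsub ht)
        have hψd : ψ t - ψ (x i) = ∫ r in (x i)..t, (γ * v r + c * e r) := by
          rw [hfe]; simp only [hψ]; ring
        rw [hψd]
        have hcs := sq_intervalIntegral_le ht.1
          (((H.integrable.const_mul γ).add
            ((H.continuousOn.intervalIntegrable_of_Icc hab).const_mul c)).mono_Icc hxi (hsub ht))
          (hfl.mono_Icc hxi (hsub ht))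
        refine hcs.trans ?_
        have hmono := integral_sq_mono (v := fun r => γ * v r + c * e r) (H.restrict hi hfl)
          le_rfl ht.1 ht.2
        have h2 : t - x i ≤ hm := by linarith [ht.2, H.length_le i hi]
        exact mul_le_mul h2 hmono
          (intervalIntegral.integral_nonneg ht.1 fun _ _ => sq_nonneg _) hm0.le)
      (H.node i hi)
    have hsψ : IntervalIntegrable (fun t => w t * ((s i).eval t * ψ t)) volume
        (x i) (x (i + 1)) :=
      hwi.mul_continuousOn ((s i).continuous.continuousOn.mul
        (by rw [uIcc_of_le hlt.le]; exact hψc.mono hsub))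
    have h2 := integral_mono_off_countable hlt.le H.countable hsψ
      ((H.restrict hi hvψ).add
        (intervalIntegrable_const (c := w₁ ^ 2 * ε ^ 2 / (4 * η) + η * B)))
      (fun t ht => by
        have ha := H.approx i hi t ht
        have hb := mul_le_mul_of_nonneg_left (hψB t (hsub (Ioo_subset_Icc_self ht.1))) hη.le
        have hcc : (v t - w t * (s i).eval t) ^ 2 / (4 * η) ≤ w₁ ^ 2 * ε ^ 2 / (4 * η) := by
          gcongr
        have hdd : 0 ≤ (v t - w t * (s i).eval t) ^ 2 / (4 * η) + η * ψ t ^ 2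
            + (v t - w t * (s i).eval t) * ψ t := by
          have : (v t - w t * (s i).eval t) ^ 2 / (4 * η) + η * ψ t ^ 2
            + (v t - w t * (s i).eval t) * ψ t
            = (v t - w t * (s i).eval t + 2 * η * ψ t) ^ 2 / (4 * η) := by
            field_simp
            ring
          rw [this]
          positivity
        linarith)
    rw [intervalIntegral.integral_add (H.restrict hi hvψ) intervalIntegrable_const,
      intervalIntegral.integral_const, smul_eq_mul] at h2
    linarith
  have hsum := Finset.sum_le_sum hel
  rw [Finset.sum_add_distrib, Finset.sum_add_distrib, Finset.sum_add_distrib, ← Finset.mul_sum,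
    ← Finset.mul_sum, ← Finset.mul_sum, H.sum_length, H.sum_integral hvψ, H.sum_integral hfl,
    ← hS] at hsum
  have hneg := integral_deriv_mul_flux_nonpos (γ := γ) hab hc H.countable H.continuousOn
    H.eq_zero_left H.eq_zero_right H.hasDerivAt H.integrable K
  have hflle := integral_flux_sq_le (γ := γ) (c := c) hab H.continuousOn H.integrable
    H.integrable_sq fun t ht => H.sq_le ht
  rw [← hD] at hflle
  have h7 := mul_le_mul_of_nonneg_left hflle (by positivity : 0 ≤ hm * w₁)
  linarith

end FluxSystem

/-- Stability of a `FluxSystem` on fine meshes, with constants independent of the mesh. -/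
theorem FluxSystem.exists_bound (γ c w₀ w₁ d : ℝ) (hc : 0 ≤ c) (hw₀ : 0 < w₀) (hw₁ : 0 < w₁)
    (hd : 0 < d) :
    ∃ h₀ C : ℝ, 0 < h₀ ∧ 0 < C ∧
      ∀ (p N : ℕ) (a b hm ε K : ℝ) (x : ℕ → ℝ) (g A : ℕ → ℕ → ℝ) (w e v : ℝ → ℝ) (P : Set ℝ)
        (s : ℕ → Polynomial ℝ), b - a = d → 0 < hm → hm ≤ h₀ →
        FluxSystem p N γ c w₀ w₁ a b hm ε K x g A w e v P s →
        ∫ t in a..b, v t ^ 2 ≤ C * ε ^ 2 := by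
  set C₁ := 2 * γ ^ 2 * d + 2 * c ^ 2 * d ^ 3 with hC₁
  set C₂ := 2 * γ ^ 2 + 2 * c ^ 2 * d ^ 2 with hC₂
  set L := 2 * w₁ + 2 * w₁ ^ 2 * d with hL
  set L' := 3 * (1 + (C₁ * L + 1) * (w₁ * d)) / (w₀ * d) with hL'
  set M := (2 * (C₁ * L) + 2 * L') * d with hM
  set M' := 1 + w₁ * (C₂ * L) with hM'
  have hC₁0 : 0 ≤ C₁ := by positivity
  have hC₂0 : 0 ≤ C₂ := by positivity
  have hL0 : 0 < L := by positivity
  have hL'0 : 0 < L' := by positivity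
  have hM0 : 0 < M := by positivity
  have hM'0 : 0 < M' := by positivity
  set R := w₁ * d + w₁ ^ 2 * M * d + 1 / 2 with hR
  have hR0 : 0 < R := by positivity
  refine ⟨1 / (4 * M'), L * (4 * R + 1), by positivity, by positivity, ?_⟩
  intro p N a b hm ε K x g A w e v P s hba hm0 hmle H
  set S := ∑ i ∈ Finset.range N, ∫ t in (x i)..(x (i + 1)), w t * (s i).eval t ^ 2 with hS
  set D := ∫ t in a..b, v t ^ 2 with hD
  have hS0 : 0 ≤ S := Finset.sum_nonneg fun i hi =>
    intervalIntegral.integral_nonneg (H.lt_succ i (Finset.mem_range.1 hi)).le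
      fun t _ => mul_nonneg (H.weight_nonneg hw₀ t) (sq_nonneg _)
  have hε0 := sq_nonneg ε
  have h1 := H.integral_deriv_sq_le hw₀
  have h2 := H.const_sq_le
  have h3 := H.energy_le hw₀ hc hm0 (η := 1 / (4 * M)) (by positivity) hS hD
  rw [← hS, ← hD, hba] at h1 h2
  rw [hba] at h3
  have hDL : D ≤ L * (S + ε ^ 2) := by
    have e1 : 0 ≤ w₁ ^ 2 * d * S := by positivity
    have e2 : 0 ≤ w₁ * ε ^ 2 := by positivity
    rw [hL]; linarith
  have hKL : K ^ 2 ≤ L' * (S + ε ^ 2) := by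
    rw [hL', div_mul_eq_mul_div, le_div_iff₀ (by positivity)]
    refine h2.trans ?_
    rw [← hC₁]
    have e1 : C₁ * D ≤ C₁ * (L * (S + ε ^ 2)) := by gcongr
    have e2 : (C₁ * D + ε ^ 2) * (w₁ * d) ≤ (C₁ * (L * (S + ε ^ 2)) + (S + ε ^ 2)) * (w₁ * d) := by
      gcongr
      linarith
    linarith
  have hηt : 1 / (4 * M) * (2 * (C₁ * D) + 2 * K ^ 2) * d ≤ (S + ε ^ 2) / 4 := by
    calc 1 / (4 * M) * (2 * (C₁ * D) + 2 * K ^ 2) * d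
        ≤ 1 / (4 * M) * (2 * (C₁ * (L * (S + ε ^ 2))) + 2 * (L' * (S + ε ^ 2))) * d := by gcongr
      _ = 1 / (4 * M) * (M * (S + ε ^ 2)) := by rw [hM]; ring
      _ = (S + ε ^ 2) / 4 := by field_simp
  have hht : hm * (S + w₁ * (C₂ * D)) ≤ (S + ε ^ 2) / 4 := by
    calc hm * (S + w₁ * (C₂ * D))
        ≤ 1 / (4 * M') * ((S + ε ^ 2) + w₁ * (C₂ * (L * (S + ε ^ 2)))) := by
          gcongr
          · have : 0 ≤ D := intervalIntegral.integral_nonneg H.le fun _ _ => sq_nonneg _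
            positivity
          · linarith
      _ = 1 / (4 * M') * (M' * (S + ε ^ 2)) := by rw [hM']; ring
      _ = (S + ε ^ 2) / 4 := by field_simp
  have hε1 : w₁ ^ 2 * ε ^ 2 / (4 * (1 / (4 * M))) * d = w₁ ^ 2 * M * d * ε ^ 2 := by
    field_simp
  have hSR : S ≤ 4 * R * ε ^ 2 := by
    rw [add_mul, hε1] at h3
    rw [hR]
    linarith
  calc D ≤ L * (S + ε ^ 2) := hDL
    _ ≤ L * (4 * R * ε ^ 2 + ε ^ 2) := by gcongr
    _ = L * (4 * R + 1) * ε ^ 2 := by ring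

theorem exists_derivative_eq {n : ℕ} {T : Polynomial ℝ} (hT : T.degree < n) :
    ∃ S : Polynomial ℝ, S.degree < (n + 1 : ℕ) ∧ Polynomial.derivative S = T := by
  refine ⟨∑ i ∈ T.support, Polynomial.C (T.coeff i / (i + 1)) * Polynomial.X ^ (i + 1), ?_, ?_⟩
  · rw [← Polynomial.mem_degreeLT]
    refine Submodule.sum_mem _ fun i hi => ?_
    rw [Polynomial.mem_degreeLT]
    refine (Polynomial.degree_C_mul_X_pow_le _ _).trans_lt ?_
    have : (i : WithBot ℕ) < n := (Polynomial.le_degree_of_mem_supp i hi).trans_lt hT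
    have : i < n := by exact_mod_cast this
    exact_mod_cast Nat.succ_lt_succ this
  · conv_rhs => rw [T.as_sum_support_C_mul_X_pow]
    rw [Polynomial.derivative_sum]
    refine Finset.sum_congr rfl fun i _ => ?_
    rw [Polynomial.derivative_C_mul_X_pow, Nat.add_sub_cancel]
    congr 2
    push_cast
    field_simp

/-- Taylor approximation for a chain of successive derivatives. -/
theorem exists_polynomial_approx {y z M : ℝ} (hyz : y ≤ z) (n : ℕ) :
    ∀ q : ℕ → ℝ → ℝ,
      (∀ j < n, ∀ t ∈ Icc y z, HasDerivWithinAt (q j) (q (j + 1) t) (Icc y z) t) →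
      (∀ t ∈ Icc y z, |q n t| ≤ M) →
      ∃ T : Polynomial ℝ, T.degree < n ∧ ∀ t ∈ Icc y z, |q 0 t - T.eval t| ≤ M * (z - y) ^ n := by
  induction n with
  | zero =>
    intro q _ hM
    exact ⟨0, by simp, by simpa using hM⟩
  | succ n ih =>
    intro q hq hM
    obtain ⟨T, hT, hTq⟩ := ih (fun j => q (j + 1)) (fun j hj => hq (j + 1) (by omega)) hM
    obtain ⟨S, hS, hST⟩ := exists_derivative_eq hT
    have hy : y ∈ Icc y z := left_mem_Icc.2 hyz
    have hM0 : 0 ≤ M := (abs_nonneg _).trans (hM y hy)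
    refine ⟨S + Polynomial.C (q 0 y - S.eval y), ?_, fun t ht => ?_⟩
    · rw [← Polynomial.mem_degreeLT] at hS ⊢
      refine Submodule.add_mem _ hS ?_
      rw [Polynomial.mem_degreeLT]
      exact Polynomial.degree_C_le.trans_lt (by exact_mod_cast Nat.succ_pos n)
    · have h := Convex.norm_image_sub_le_of_norm_hasDerivWithin_le
        (f := fun r => q 0 r - S.eval r) (f' := fun r => q 1 r - T.eval r)
        (fun r hr => (hq 0 (Nat.succ_pos n) r hr).sub
          (by rw [← hST]; exact (S.hasDerivAt r).hasDerivWithinAt))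
        (fun r hr => hTq r hr) (convex_Icc y z) hy ht
      simp only [Real.norm_eq_abs] at h
      have h1 : |t - y| ≤ z - y := by
        rw [abs_of_nonneg (by linarith [ht.1])]; linarith [ht.2]
      have h2 : q 0 t - (S + Polynomial.C (q 0 y - S.eval y)).eval t
          = q 0 t - S.eval t - (q 0 y - S.eval y) := by
        simp; ring
      rw [h2]
      refine h.trans ?_
      rw [pow_succ, ← mul_assoc]
      exact mul_le_mul_of_nonneg_left h1 (mul_nonneg hM0 (pow_nonneg (by linarith) _))

theorem eq_zero_of_iterate_derivative_eval {n : ℕ} {R : Polynomial ℝ} {r : ℝ}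
    (hR : R.natDegree ≤ n) (h : ∀ j ≤ n, (Polynomial.derivative^[j] R).eval r = 0) : R = 0 := by
  refine Polynomial.eq_zero_of_hasseDeriv_eq_zero R r fun j => ?_
  rcases le_or_gt j n with hj | hj
  · have h1 := h j hj
    rw [← Polynomial.factorial_smul_hasseDeriv] at h1
    rw [LinearMap.smul_apply, Polynomial.eval_smul, nsmul_eq_mul] at h1
    exact (mul_eq_zero.1 h1).resolve_left (by exact_mod_cast j.factorial_ne_zero)
  · rw [Polynomial.hasseDeriv_eq_zero_of_lt_natDegree _ _ (by omega)]
    simp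

section Coefficient

variable {βm βp α : ℝ}

theorem betaPW_pos (hβm : 0 < βm) (hβp : 0 < βp) (t : ℝ) : 0 < betaPW βm βp α t := by
  unfold betaPW; split_ifs <;> assumption

theorem betaPW_of_lt {t : ℝ} (ht : t < α) : betaPW βm βp α t = βm := if_pos ht

theorem betaPW_of_ge {t : ℝ} (ht : α ≤ t) : betaPW βm βp α t = βp := if_neg ht.not_gt

theorem intervalIntegrable_betaPW (r₁ r₂ α y z : ℝ) :
    IntervalIntegrable (betaPW r₁ r₂ α) volume y z := by
  have hmeas : Measurable (betaPW r₁ r₂ α) :=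
    Measurable.ite measurableSet_Iio measurable_const measurable_const
  rw [intervalIntegrable_iff]
  refine Measure.integrableOn_of_bounded (M := max |r₁| |r₂|) (by simp)
    hmeas.aestronglyMeasurable (Filter.Eventually.of_forall fun t => ?_)
  unfold betaPW
  split_ifs <;> simp

theorem inv_betaPW (t : ℝ) : (betaPW βm βp α t)⁻¹ = betaPW βm⁻¹ βp⁻¹ α t := by
  unfold betaPW; split_ifs <;> rfl

theorem betaPW_sq (t : ℝ) : betaPW βm βp α t ^ 2 = betaPW (βm ^ 2) (βp ^ 2) α t := by
  unfold betaPW; split_ifs <;> rfl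

end Coefficient

theorem mesh_exists_mem_Ioo {N : ℕ} {x : ℕ → ℝ} {t : ℝ} (h0 : x 0 < t) (hN : t < x N)
    (ht : t ∉ range x) : ∃ i < N, t ∈ Ioo (x i) (x (i + 1)) := by
  induction N with
  | zero => exact absurd (h0.trans hN) (lt_irrefl _)
  | succ n ih =>
    rcases lt_trichotomy t (x n) with h | h | h
    · obtain ⟨i, hi, hit⟩ := ih h
      exact ⟨i, by omega, hit⟩
    · exact absurd ⟨n, h.symm⟩ ht
    · exact ⟨n, by omega, h, hN⟩

theorem IntervalIntegrable.of_eq_mul_off_countable {N : ℕ} {x : ℕ → ℝ} {w F : ℝ → ℝ} {P : Set ℝ}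
    (hP : P.Countable) (hx : ∀ i < N, x i < x (i + 1))
    (hw : ∀ y z, IntervalIntegrable w volume y z)
    (hF : ∀ i < N, ∃ G : ℝ → ℝ, ContinuousOn G (Icc (x i) (x (i + 1))) ∧
      ∀ t ∈ Ioo (x i) (x (i + 1)) \ P, F t = w t * G t) :
    IntervalIntegrable F volume (x 0) (x N) := by
  refine IntervalIntegrable.trans_iterate fun i hi => ?_
  obtain ⟨G, hG, hFG⟩ := hF i hi
  have hle := (hx i hi).le
  refine ((hw (x i) (x (i + 1))).mul_continuousOn (by rwa [uIcc_of_le hle])).congr_ae ?_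
  rw [uIoc_of_le hle, ← restrict_Ioo_eq_restrict_Ioc]
  filter_upwards [ae_restrict_mem measurableSet_Ioo,
    (hP.ae_notMem volume).filter_mono (ae_mono Measure.restrict_le_self)] with t ht hPt
  exact (hFG t ⟨ht, hPt⟩).symm

section Trial

variable {p N k : ℕ} {a b α βm βp : ℝ} {x : ℕ → ℝ} {v : ℝ → ℝ}

theorem hasDerivAt_of_eqOn_polynomial {q : Polynomial ℝ} {y z t : ℝ}
    (h : ∀ s ∈ Icc y z, v s = q.eval s) (ht : t ∈ Ioo y z) :
    HasDerivAt v (q.derivative.eval t) t :=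
  (q.hasDerivAt t).congr_of_eventuallyEq
    (Filter.eventuallyEq_of_mem (Icc_mem_nhds ht.1 ht.2) h)

theorem natDegree_C_mul_derivative_le {q : Polynomial ℝ} (hq : q.natDegree ≤ p) (r : ℝ) :
    (Polynomial.C r * q.derivative).natDegree ≤ p - 1 :=
  (Polynomial.natDegree_C_mul_le _ _).trans
    ((Polynomial.natDegree_derivative_le q).trans (Nat.sub_le_sub_right hq 1))

/-- On each element the flux `β v'` of a trial function is a single polynomial. -/
theorem MemUT.exists_flux (hv : MemUT p N k a b α βm βp x v) (hp : 1 ≤ p)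
    (hβm : 0 < βm) (hβp : 0 < βp) (hk1 : 1 ≤ k) (hkN : k ≤ N)
    (hx : ∀ i < N, x i < x (i + 1)) (hαl : x (k - 1) < α) (hαr : α < x k) {i : ℕ} (hi : i < N) :
    ∃ Q : Polynomial ℝ, Q.natDegree ≤ p - 1 ∧ ∀ t ∈ Ioo (x i) (x (i + 1)), t ≠ α →
      HasDerivAt v ((betaPW βm βp α t)⁻¹ * Q.eval t) t := by
  obtain ⟨-, -, -, hel, qm, qp, hqm, hqp, hvm, hvp, hjump⟩ := hv
  by_cases hik : i + 1 = k
  · have hki : k - 1 = i := by omega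
    rw [hki] at hvm
    rw [← hik] at hvp
    have hR : Polynomial.C βm * qm.derivative - Polynomial.C βp * qp.derivative = 0 := by
      refine eq_zero_of_iterate_derivative_eval (n := p - 1) (r := α)
        ((Polynomial.natDegree_sub_le_of_le (natDegree_C_mul_derivative_le hqm _)
          (natDegree_C_mul_derivative_le hqp _)).trans (max_self _).le) fun j hj => ?_
      have := hjump (j + 1) (by omega) (by omega)
      rw [Function.iterate_succ_apply, Function.iterate_succ_apply] at this
      rw [Polynomial.iterate_derivative_sub, Polynomial.iterate_derivative_C_mul,
        Polynomial.iterate_derivative_C_mul]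
      simp [this]
    refine ⟨Polynomial.C βm * qm.derivative, natDegree_C_mul_derivative_le hqm _,
      fun t ht htα => ?_⟩
    rcases lt_or_gt_of_ne htα with h | h
    · rw [betaPW_of_lt h, Polynomial.eval_mul, Polynomial.eval_C,
        inv_mul_cancel_left₀ hβm.ne']
      exact hasDerivAt_of_eqOn_polynomial hvm ⟨ht.1, h⟩
    · rw [betaPW_of_ge h.le, sub_eq_zero.1 hR, Polynomial.eval_mul, Polynomial.eval_C,
        inv_mul_cancel_left₀ hβp.ne']
      exact hasDerivAt_of_eqOn_polynomial hvp ⟨h, ht.2⟩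
  · obtain ⟨q, hq, hvq⟩ := hel (i + 1) (by omega) (by omega) hik
    rw [Nat.add_sub_cancel] at hvq
    rcases lt_or_gt_of_ne hik with h | h
    · refine ⟨Polynomial.C βm * q.derivative, natDegree_C_mul_derivative_le hq _,
        fun t ht _ => ?_⟩
      have : t < α := (ht.2.trans_le (mesh_mono hx (by omega) (by omega))).trans hαl
      rw [betaPW_of_lt this, Polynomial.eval_mul, Polynomial.eval_C,
        inv_mul_cancel_left₀ hβm.ne']
      exact hasDerivAt_of_eqOn_polynomial hvq ht
    · refine ⟨Polynomial.C βp * q.derivative, natDegree_C_mul_derivative_le hq _,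
        fun t ht _ => ?_⟩
      have : α < t := hαr.trans ((mesh_mono hx (by omega) (by omega)).trans_lt ht.1)
      rw [betaPW_of_ge this.le, Polynomial.eval_mul, Polynomial.eval_C,
        inv_mul_cancel_left₀ hβp.ne']
      exact hasDerivAt_of_eqOn_polynomial hvq ht

end Trial

section Exact

variable {m : ℕ} {a b α βm βp : ℝ} {u : ℝ → ℝ}

/-- The derivatives `(β u')⁽ʲ⁾` of the flux of a piecewise smooth function. -/
noncomputable def fluxDeriv (a b α βm βp : ℝ) (u : ℝ → ℝ) (j : ℕ) (t : ℝ) : ℝ :=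
  if t < α then βm * iteratedDerivWithin (j + 1) u (Icc a α) t
  else βp * iteratedDerivWithin (j + 1) u (Icc α b) t

theorem MemW.fluxDeriv_eq_left (hu : MemW m a b α βm βp u) {j : ℕ} (hj : j + 1 ≤ m) {t : ℝ}
    (ht : t ≤ α) :
    fluxDeriv a b α βm βp u j t = βm * iteratedDerivWithin (j + 1) u (Icc a α) t := by
  unfold fluxDeriv
  split_ifs with h
  · rfl
  · obtain rfl : t = α := le_antisymm ht (not_lt.1 h)
    exact (hu.2.2.2.2.2 (j + 1) (by omega) hj).symm

theorem fluxDeriv_eq_right {j : ℕ} {t : ℝ} (ht : α ≤ t) :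
    fluxDeriv a b α βm βp u j t = βp * iteratedDerivWithin (j + 1) u (Icc α b) t :=
  if_neg ht.not_gt

theorem hasDerivWithinAt_iteratedDerivWithin {y z : ℝ} (hyz : y < z)
    (hu : ContDiffOn ℝ (m : ℕ∞) u (Icc y z)) {j : ℕ} (hj : j < m) {t : ℝ} (ht : t ∈ Icc y z) :
    HasDerivWithinAt (iteratedDerivWithin j u (Icc y z))
      (iteratedDerivWithin (j + 1) u (Icc y z) t) (Icc y z) t := by
  rw [iteratedDerivWithin_succ]
  exact (hu.differentiableOn_iteratedDerivWithin (by exact_mod_cast hj)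
    (uniqueDiffOn_Icc hyz) t ht).hasDerivWithinAt

theorem MemW.hasDerivWithinAt_fluxDeriv (hu : MemW m a b α βm βp u) (haα : a < α) (hαb : α < b)
    {j : ℕ} (hj : j + 1 < m) (t : ℝ) :
    HasDerivWithinAt (fluxDeriv a b α βm βp u j) (fluxDeriv a b α βm βp u (j + 1) t)
      (Icc a b) t := by
  rw [← Icc_union_Icc_eq_Icc haα.le hαb.le]
  refine HasDerivWithinAt.union ?_ ?_
  · by_cases ht : t ∈ Icc a α
    · rw [hu.fluxDeriv_eq_left (by omega) ht.2]
      exact ((hasDerivWithinAt_iteratedDerivWithin haα hu.2.2.2.1 hj ht).const_mul βm).congr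
        (fun s hs => hu.fluxDeriv_eq_left (by omega) hs.2)
        (hu.fluxDeriv_eq_left (by omega) ht.2)
    · exact HasFDerivWithinAt.of_notMem_closure (by rwa [isClosed_Icc.closure_eq])
  · by_cases ht : t ∈ Icc α b
    · rw [fluxDeriv_eq_right ht.1]
      exact ((hasDerivWithinAt_iteratedDerivWithin hαb hu.2.2.2.2.1 hj ht).const_mul βp).congr
        (fun s hs => fluxDeriv_eq_right hs.1) (fluxDeriv_eq_right ht.1)
    · exact HasFDerivWithinAt.of_notMem_closure (by rwa [isClosed_Icc.closure_eq])

theorem MemW.fluxDeriv_eq_mul_iteratedDeriv (hu : MemW m a b α βm βp u) {j : ℕ} (hj : j + 1 ≤ m)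
    {t : ℝ} (ht : t ∈ Ioo a α ∪ Ioo α b) :
    fluxDeriv a b α βm βp u j t = betaPW βm βp α t * iteratedDeriv (j + 1) u t := by
  have hcast : ((j + 1 : ℕ) : WithTop ℕ∞) ≤ ((m : ℕ∞) : WithTop ℕ∞) := by exact_mod_cast hj
  rcases ht with ht | ht
  · rw [hu.fluxDeriv_eq_left hj ht.2.le, betaPW_of_lt ht.2, iteratedDerivWithin_eq_iteratedDeriv
      (uniqueDiffOn_Icc (ht.1.trans ht.2))
      ((hu.2.2.2.1.of_le hcast).contDiffAt (Icc_mem_nhds ht.1 ht.2)) (Ioo_subset_Icc_self ht)]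
  · rw [fluxDeriv_eq_right ht.1.le, betaPW_of_ge ht.1.le, iteratedDerivWithin_eq_iteratedDeriv
      (uniqueDiffOn_Icc (ht.1.trans ht.2))
      ((hu.2.2.2.2.1.of_le hcast).contDiffAt (Icc_mem_nhds ht.1 ht.2)) (Ioo_subset_Icc_self ht)]

theorem MemW.differentiableAt (hu : MemW m a b α βm βp u) (hm : 1 ≤ m)
    {t : ℝ} (ht : t ∈ Ioo a α ∪ Ioo α b) : DifferentiableAt ℝ u t := by
  have hcast : ((m : ℕ∞) : WithTop ℕ∞) ≠ 0 := by
    have : m ≠ 0 := by omega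
    exact_mod_cast this
  rcases ht with ht | ht
  · exact (hu.2.2.2.1.contDiffAt (Icc_mem_nhds ht.1 ht.2)).differentiableAt hcast
  · exact (hu.2.2.2.2.1.contDiffAt (Icc_mem_nhds ht.1 ht.2)).differentiableAt hcast

theorem bddAbove_abs_iteratedDerivWithin {y z : ℝ} (hyz : y < z)
    (hu : ContDiffOn ℝ (m : ℕ∞) u (Icc y z)) :
    BddAbove {r : ℝ | ∃ j ≤ m, ∃ t ∈ Icc y z, r = |iteratedDerivWithin j u (Icc y z) t|} := by
  have h : BddAbove (⋃ j ∈ Iic m, (fun t => |iteratedDerivWithin j u (Icc y z) t|) '' Icc y z) := by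
    refine (finite_Iic m).bddAbove_biUnion.2 fun j hj => ?_
    exact isCompact_Icc.bddAbove_image (hu.continuousOn_iteratedDerivWithin
      (by exact_mod_cast hj) (uniqueDiffOn_Icc hyz)).abs
  refine h.mono ?_
  rintro r ⟨j, hj, t, ht, rfl⟩
  exact mem_biUnion (mem_Iic.2 hj) ⟨t, ht, rfl⟩

theorem MemW.abs_fluxDeriv_le (hu : MemW m a b α βm βp u) (haα : a < α) (hαb : α < b)
    (hβm : 0 < βm) (hβp : 0 < βp) {j : ℕ} (hj : j + 1 ≤ m) {t : ℝ} (ht : t ∈ Icc a b) :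
    |fluxDeriv a b α βm βp u j t| ≤ max βm βp * wnorm m a b α u := by
  rcases le_or_gt t α with h | h
  · have h1 : |iteratedDerivWithin (j + 1) u (Icc a α) t| ≤ wnorm m a b α u :=
      (le_csSup (bddAbove_abs_iteratedDerivWithin haα hu.2.2.2.1)
        ⟨j + 1, hj, t, ⟨ht.1, h⟩, rfl⟩).trans (le_max_left _ _)
    rw [hu.fluxDeriv_eq_left hj h, abs_mul, abs_of_pos hβm]
    exact mul_le_mul (le_max_left _ _) h1 (abs_nonneg _) (hβm.le.trans (le_max_left _ _))
  · have h1 : |iteratedDerivWithin (j + 1) u (Icc α b) t| ≤ wnorm m a b α u :=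
      (le_csSup (bddAbove_abs_iteratedDerivWithin hαb hu.2.2.2.2.1)
        ⟨j + 1, hj, t, ⟨h.le, ht.2⟩, rfl⟩).trans (le_max_right _ _)
    rw [fluxDeriv_eq_right h.le, abs_mul, abs_of_pos hβp]
    exact mul_le_mul (le_max_right _ _) h1 (abs_nonneg _) (hβm.le.trans (le_max_left _ _))

end Exact

/-- A nodal quantity which is unchanged in passing from each node to the next one is constant. -/
theorem nodal_const {p N : ℕ} (hp : 1 ≤ p) {G : ℕ → ℕ → ℝ}
    (hin : ∀ i < N, ∀ j, 1 ≤ j → j < p → G i j = G i (j + 1))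
    (hout : ∀ i, i + 1 < N → G i p = G (i + 1) 1) :
    ∀ i < N, ∀ j ∈ Finset.Icc 1 p, G i j = G 0 1 := by
  have hrow : ∀ i < N, ∀ j, 1 ≤ j → j ≤ p → G i j = G i 1 := by
    intro i hi j hj
    induction j, hj using Nat.le_induction with
    | base => intro _; rfl
    | succ n hn ih => intro hnp; rw [← hin i hi n hn (by omega), ih (by omega)]
  have hcol : ∀ i < N, G i 1 = G 0 1 := by
    intro i
    induction i with
    | zero => intro _; rfl
    | succ n ih =>
      intro hn
      rw [← hout n hn, hrow n (by omega) p hp le_rfl, ih (by omega)]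
  intro i hi j hj
  rw [Finset.mem_Icc] at hj
  rw [hrow i hi j hj.1 hj.2, hcol i hi]

/-- for `c > 0` and `A_{i,j} ≥ κ hᵢ`, if `u ∈ W̃_β^{p+1,∞}` solves the
interface problem and `u_T ∈ U_T` is an IFVM solution with the same data, then there are
`h₀ > 0` and `C > 0`, depending only on `p`, `β⁻`, `β⁺`, `γ`, `c`, `κ` and `b−a`, with the
optimal-order `H¹` error estimate `|u − u_T|₁ ≤ C h^p ‖u‖_{p+1,∞}` for `h ≤ h₀`. -/
theorem stmt_13 (p : ℕ) (hp : 1 ≤ p) (βm βp γ c κ d : ℝ)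
    (hβm : 0 < βm) (hβp : 0 < βp) (hc : 0 < c) (hκ : 0 < κ) (hd : 0 < d) :
    ∃ h₀ C : ℝ, 0 < h₀ ∧ 0 < C ∧
    (∀ (N k : ℕ) (a b α hm : ℝ) (x : ℕ → ℝ) (g A : ℕ → ℕ → ℝ),
    b - a = d →
    1 ≤ N →
    1 ≤ k →
    k ≤ N →
    a < b →
    x 0 = a →
    x N = b →
    (∀ i, i < N → x i < x (i + 1)) →
    x (k - 1) < α →
    α < x k →
    (∀ i ∈ Finset.Icc 1 N, ∀ j ∈ Finset.Icc 1 p,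
      x (i - 1) < g i j ∧ g i j < x i ∧ g i j ≠ α) →
    (∀ i ∈ Finset.Icc 1 N, ∀ j, 1 ≤ j → j < p → g i j < g i (j + 1)) →
    (∀ i, 1 ≤ i → i < N → g i (p + 1) = g (i + 1) 1) →
    (∀ i ∈ Finset.Icc 1 N, ∀ j ∈ Finset.Icc 1 p, 0 < A i j) →
    (∀ i ∈ Finset.Icc 1 N, ∀ F : Polynomial ℝ, F.natDegree ≤ 2 * p - 1 →
      ∑ j ∈ Finset.Icc 1 p, A i j * F.eval (g i j)
        = ∫ t in (x (i - 1))..(x i), F.eval t / betaPW βm βp α t) →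
    (∀ i ∈ Finset.Icc 1 N, ∀ j ∈ Finset.Icc 1 p, κ * (x i - x (i - 1)) ≤ A i j) →
    (∀ i ∈ Finset.Icc 1 N, x i - x (i - 1) ≤ hm) →
    hm ≤ h₀ →
    ∀ (f u uT : ℝ → ℝ),
    ContinuousOn f (Set.Ioo a α ∪ Set.Ioo α b) →
    (∃ Mf : ℝ, ∀ t ∈ Set.Icc a b, |f t| ≤ Mf) →
    MemW (p + 1) a b α βm βp u →
    (∀ t, t ∈ Set.Ioo a α ∪ Set.Ioo α b →
      -(betaPW βm βp α t * iteratedDeriv 2 u t) + γ * deriv u t + c * u t = f t) →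
    MemUT p N k a b α βm βp x uT →
    (∀ i, 1 ≤ i → i ≤ N → ∀ j, 1 ≤ j → j ≤ (if i < N then p else p - 1) →
      betaPW βm βp α (g i j) * deriv uT (g i j)
        - betaPW βm βp α (g i (j + 1)) * deriv uT (g i (j + 1))
        + (∫ t in (g i j)..(g i (j + 1)), (γ * deriv uT t + c * uT t))
        = ∫ t in (g i j)..(g i (j + 1)), f t) →
    Real.sqrt (∫ t in a..b, (deriv (fun s => u s - uT s) t) ^ 2)
      ≤ C * hm ^ p * wnorm (p + 1) a b α u) := by
  obtain ⟨h₀, C, hh₀, hC, hstab⟩ := FluxSystem.exists_bound γ c (min βm⁻¹ βp⁻¹) (max βm⁻¹ βp⁻¹) d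
    hc.le (lt_min (inv_pos.2 hβm) (inv_pos.2 hβp)) (lt_max_of_lt_left (inv_pos.2 hβm)) hd
  have hβmax : 0 < max βm βp := lt_max_of_lt_left hβm
  refine ⟨h₀, Real.sqrt C * max βm βp, hh₀, mul_pos (Real.sqrt_pos.2 hC) hβmax, ?_⟩
  intro N k a b α hm x g A hba hN hk1 hkN hab hx0 hxN hx hαl hαr hg _ hgout hA hquad _ hlen hmle
    f u uT _ _ hu hpde huT hfv
  have hxmem : ∀ i ≤ N, x i ∈ Icc a b := fun i hi =>
    ⟨hx0 ▸ mesh_mono hx (Nat.zero_le i) hi, hxN ▸ mesh_mono hx hi le_rfl⟩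
  have haα : a < α := (hxmem (k - 1) (by omega)).1.trans_lt hαl
  have hαb : α < b := hαr.trans_le (hxmem k hkN).2
  have hlen' : ∀ i < N, x (i + 1) - x i ≤ hm := fun i hi => by
    simpa using hlen (i + 1) (Finset.mem_Icc.2 ⟨by omega, hi⟩)
  have hm0 : 0 < hm := by
    have := hlen' 0 (by omega)
    have := hx 0 (by omega)
    linarith
  set w : ℝ → ℝ := fun t => (betaPW βm βp α t)⁻¹ with hw
  have hβpos := betaPW_pos (α := α) hβm hβp
  have hwint : ∀ y z, IntervalIntegrable w volume y z := fun y z => by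
    have : w = betaPW βm⁻¹ βp⁻¹ α := funext inv_betaPW
    rw [this]; exact intervalIntegrable_betaPW _ _ _ _ _
  have hw2int : ∀ y z, IntervalIntegrable (fun t => w t ^ 2) volume y z := fun y z => by
    have : (fun t => w t ^ 2) = betaPW (βm⁻¹ ^ 2) (βp⁻¹ ^ 2) α := by
      funext t; simp only [hw]; rw [inv_betaPW, betaPW_sq]
    rw [this]; exact intervalIntegrable_betaPW _ _ _ _ _
  set q : ℕ → ℝ → ℝ := fluxDeriv a b α βm βp u with hq
  have hqd : ∀ j < p, ∀ t, HasDerivWithinAt (q j) (q (j + 1) t) (Icc a b) t := fun j hj t =>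
    hu.hasDerivWithinAt_fluxDeriv haα hαb (by omega) t
  have hq0c : ContinuousOn (q 0) (Icc a b) := fun t _ => (hqd 0 hp t).continuousWithinAt
  set W := wnorm (p + 1) a b α u with hWdef
  have hqp : ∀ t ∈ Icc a b, |q p t| ≤ max βm βp * W := fun t ht =>
    hu.abs_fluxDeriv_le haα hαb hβm hβp le_rfl ht
  have hβW : 0 ≤ max βm βp * W := (abs_nonneg _).trans (hqp a (left_mem_Icc.2 hab.le))
  have hsub : ∀ i < N, Icc (x i) (x (i + 1)) ⊆ Icc a b := fun i hi =>
    Icc_subset_Icc (hxmem i hi.le).1 (hxmem (i + 1) hi).2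
  set ε := max βm βp * W * hm ^ p with hε
  have hε0 : 0 ≤ ε := by positivity
  have hT : ∀ i, ∃ T : Polynomial ℝ, i < N → T.natDegree ≤ p - 1 ∧
      ∀ t ∈ Icc (x i) (x (i + 1)), |q 0 t - T.eval t| ≤ ε := by
    intro i
    by_cases hi : i < N
    · obtain ⟨T, hTd, hTq⟩ := exists_polynomial_approx (hx i hi).le p q
        (fun j hj t _ => (hqd j hj t).mono (hsub i hi)) (fun t ht => hqp t (hsub i hi ht))
      refine ⟨T, fun _ => ⟨?_, fun t ht => (hTq t ht).trans ?_⟩⟩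
      · exact Polynomial.natDegree_le_iff_coeff_eq_zero.2 fun n hn =>
          (Polynomial.degree_lt_iff_coeff_zero T p).1 hTd n (by omega)
      · have h1 := hlen' i hi
        have h2 := hx i hi
        have h3 : (x (i + 1) - x i) ^ p ≤ hm ^ p := pow_le_pow_left₀ (by linarith) h1 p
        exact mul_le_mul_of_nonneg_left h3 hβW
    · exact ⟨0, fun h => absurd h hi⟩
  choose T hT using hT
  have hQ : ∀ i, ∃ Q : Polynomial ℝ, i < N → Q.natDegree ≤ p - 1 ∧
      ∀ t ∈ Ioo (x i) (x (i + 1)), t ≠ α → HasDerivAt uT (w t * Q.eval t) t := by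
    intro i
    by_cases hi : i < N
    · obtain ⟨Q, hQ⟩ := huT.exists_flux hp hβm hβp hk1 hkN hx hαl hαr hi
      exact ⟨Q, fun _ => hQ⟩
    · exact ⟨0, fun h => absurd h hi⟩
  choose Q hQ using hQ
  set P : Set ℝ := insert α (range x) with hPdef
  have hP : P.Countable := (countable_range x).insert α
  have hPα : ∀ t ∉ P, t ≠ α := fun t ht h => ht (h ▸ mem_insert _ _)
  have hside : ∀ t ∈ Ioo a b, t ≠ α → t ∈ Ioo a α ∪ Ioo α b := by
    intro t ht h
    rcases lt_or_gt_of_ne h with h | h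
    · exact Or.inl ⟨ht.1, h⟩
    · exact Or.inr ⟨h, ht.2⟩
  have hud : ∀ t ∈ Ioo a b, t ≠ α → HasDerivAt u (w t * q 0 t) t := by
    intro t ht h
    have h1 := hu.fluxDeriv_eq_mul_iteratedDeriv (j := 0) (by omega) (hside t ht h)
    rw [iteratedDeriv_one] at h1
    have h2 : w t * q 0 t = deriv u t := by
      simp only [hw, hq]; rw [h1, inv_mul_cancel_left₀ (hβpos t).ne']
    rw [h2]
    exact (hu.differentiableAt (by omega) (hside t ht h)).hasDerivAt
  set e : ℝ → ℝ := fun s => u s - uT s with he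
  set v : ℝ → ℝ := deriv e with hv
  have hed : ∀ i < N, ∀ t ∈ Ioo (x i) (x (i + 1)), t ≠ α →
      HasDerivAt e (w t * (q 0 t - (Q i).eval t)) t := by
    intro i hi t ht h
    have h1 : t ∈ Ioo a b := ⟨(hxmem i hi.le).1.trans_lt ht.1, ht.2.trans_le (hxmem _ hi).2⟩
    rw [mul_sub]
    exact (hud t h1 h).sub ((hQ i hi).2 t ht h)
  have hvi : ∀ i < N, ∀ t ∈ Ioo (x i) (x (i + 1)), t ≠ α →
      v t = w t * (q 0 t - (Q i).eval t) := fun i hi t ht h => (hed i hi t ht h).deriv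
  have hfind : ∀ t ∈ Ioo a b \ P, ∃ i < N, t ∈ Ioo (x i) (x (i + 1)) := fun t ht =>
    mesh_exists_mem_Ioo (hx0 ▸ ht.1.1) (hxN ▸ ht.1.2) fun h => ht.2 (mem_insert_of_mem _ h)
  have hev : ∀ t ∈ Ioo a b \ P, HasDerivAt e (v t) t := by
    intro t ht
    obtain ⟨i, hi, hti⟩ := hfind t ht
    rw [hvi i hi t hti (hPα t ht.2)]
    exact hed i hi t hti (hPα t ht.2)
  have hcG : ∀ i < N, ContinuousOn (fun t => q 0 t - (Q i).eval t) (Icc (x i) (x (i + 1))) :=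
    fun i hi => (hq0c.mono (hsub i hi)).sub (Q i).continuous.continuousOn
  have hvint : IntervalIntegrable v volume a b := by
    rw [← hx0, ← hxN]
    exact IntervalIntegrable.of_eq_mul_off_countable hP hx hwint fun i hi =>
      ⟨_, hcG i hi, fun t ht => hvi i hi t ht.1 (hPα t ht.2)⟩
  have hv2int : IntervalIntegrable (fun t => v t ^ 2) volume a b := by
    rw [← hx0, ← hxN]
    exact IntervalIntegrable.of_eq_mul_off_countable hP hx hw2int fun i hi =>
      ⟨_, (hcG i hi).pow 2, fun t ht => by
        rw [hvi i hi t ht.1 (hPα t ht.2), mul_pow]; rfl⟩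
  have huTint : IntervalIntegrable (deriv uT) volume a b := by
    rw [← hx0, ← hxN]
    exact IntervalIntegrable.of_eq_mul_off_countable hP hx hwint fun i hi =>
      ⟨_, (Q i).continuous.continuousOn, fun t ht =>
        ((hQ i hi).2 t ht.1 (hPα t ht.2)).deriv⟩
  have hec : ContinuousOn e (Icc a b) := hu.1.sub huT.1
  have hgmem : ∀ i < N, ∀ j ∈ Finset.Icc 1 p,
      g (i + 1) j ∈ Ioo (x i) (x (i + 1)) ∧ g (i + 1) j ≠ α := by
    intro i hi j hj
    have := hg (i + 1) (Finset.mem_Icc.2 ⟨by omega, hi⟩) j hj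
    rw [Nat.add_sub_cancel] at this
    exact ⟨⟨this.1, this.2.1⟩, this.2.2⟩
  set φ : ℝ → ℝ := fun t => γ * e t + c * ∫ r in a..t, e r with hφ
  have hbal : ∀ y ∈ Ioo a b, ∀ z ∈ Ioo a b,
      (∫ t in y..z, f t) - ∫ t in y..z, (γ * deriv uT t + c * uT t)
        = (φ z - φ y) - (q 0 z - q 0 y) := by
    intro y hy z hz
    have hy' := Ioo_subset_Icc_self hy
    have hz' := Ioo_subset_Icc_self hz
    have hq1c : ContinuousOn (q 1) (Icc a b) := by
      have hcast : ∀ y z : ℝ, y < z → ContDiffOn ℝ ((p + 1 : ℕ) : ℕ∞) u (Icc y z) →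
          ∀ j ≤ p + 1, ContinuousOn (iteratedDerivWithin j u (Icc y z)) (Icc y z) :=
        fun y z hyz h j hj =>
          h.continuousOn_iteratedDerivWithin (by exact_mod_cast hj) (uniqueDiffOn_Icc hyz)
      rw [← Icc_union_Icc_eq_Icc haα.le hαb.le]
      refine ContinuousOn.union_of_isClosed ?_ ?_ isClosed_Icc isClosed_Icc
      · exact ((hcast a α haα hu.2.2.2.1 2 (by omega)).const_mul βm).congr fun t ht =>
          hu.fluxDeriv_eq_left (by omega) ht.2
      · exact ((hcast α b hαb hu.2.2.2.2.1 2 (by omega)).const_mul βp).congr fun t ht =>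
          fluxDeriv_eq_right ht.1
    have hq1int : IntervalIntegrable (q 1) volume a b := hq1c.intervalIntegrable_of_Icc hab.le
    have hF1 : IntervalIntegrable (fun t => γ * v t + c * e t) volume a b :=
      (hvint.const_mul _).add ((hec.intervalIntegrable_of_Icc hab.le).const_mul _)
    have hF2 : IntervalIntegrable (fun t => γ * deriv uT t + c * uT t) volume a b :=
      (huTint.const_mul _).add ((huT.1.intervalIntegrable_of_Icc hab.le).const_mul _)
    have hq1 : ∫ t in y..z, q 1 t = q 0 z - q 0 y :=
      sub_eq_integral_of_hasDerivAt_off_countable hP hq0c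
        (fun t ht => (hqd 0 hp t).hasDerivAt (Icc_mem_nhds ht.1.1 ht.1.2)) hq1int hy' hz'
    have hfl := flux_sub_eq_integral (γ := γ) (c := c) hP hec hev hvint hy' hz'
    have hf : ∫ t in y..z, f t
        = ∫ t in y..z, ((γ * v t + c * e t - q 1 t) + (γ * deriv uT t + c * uT t)) := by
      refine intervalIntegral.integral_congr_ae ?_
      filter_upwards [hP.ae_notMem volume] with t htP ht
      have htI : t ∈ Ioo a b :=
        ⟨(lt_min hy.1 hz.1).trans ht.1, ht.2.trans_lt (max_lt hy.2 hz.2)⟩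
      have htα := hPα t htP
      obtain ⟨i, hi, hti⟩ := hfind t ⟨htI, htP⟩
      have h1 := hpde t (hside t htI htα)
      rw [← hu.fluxDeriv_eq_mul_iteratedDeriv (j := 1) (by omega) (hside t htI htα)] at h1
      rw [← h1, hvi i hi t hti htα, (hud t htI htα).deriv, ((hQ i hi).2 t hti htα).deriv]
      simp only [he, hq]
      ring
    rw [hf, intervalIntegral.integral_add ((hF1.sub hq1int).mono_Icc hy' hz')
      (hF2.mono_Icc hy' hz'), intervalIntegral.integral_sub (hF1.mono_Icc hy' hz')
      (hq1int.mono_Icc hy' hz'), hq1, hfl]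
    simp only [hφ]
    ring
  have hgI : ∀ i < N, ∀ j ∈ Finset.Icc 1 p, g (i + 1) j ∈ Ioo a b := fun i hi j hj =>
    ⟨(hxmem i hi.le).1.trans_lt (hgmem i hi j hj).1.1,
      (hgmem i hi j hj).1.2.trans_le (hxmem _ hi).2⟩
  have hflux : ∀ i < N, ∀ j ∈ Finset.Icc 1 p,
      betaPW βm βp α (g (i + 1) j) * deriv uT (g (i + 1) j) = (Q i).eval (g (i + 1) j) := by
    intro i hi j hj
    rw [((hQ i hi).2 _ (hgmem i hi j hj).1 (hgmem i hi j hj).2).deriv,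
      mul_inv_cancel_left₀ (hβpos _).ne']
  set G : ℕ → ℕ → ℝ := fun i j =>
    q 0 (g (i + 1) j) - (Q i).eval (g (i + 1) j) - φ (g (i + 1) j) with hGdef
  have hG : ∀ i < N, ∀ j ∈ Finset.Icc 1 p, G i j = G 0 1 := by
    refine nodal_const hp ?_ ?_
    · intro i hi j hj1 hjp
      have hj : j ∈ Finset.Icc 1 p := Finset.mem_Icc.2 ⟨hj1, hjp.le⟩
      have hj' : j + 1 ∈ Finset.Icc 1 p := Finset.mem_Icc.2 ⟨by omega, hjp⟩
      have h1 := hfv (i + 1) (by omega) hi j hj1 (by split_ifs <;> omega)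
      rw [hflux i hi j hj, hflux i hi (j + 1) hj'] at h1
      have h2 := hbal _ (hgI i hi j hj) _ (hgI i hi (j + 1) hj')
      simp only [hGdef]
      linarith
    · intro i hi
      have hj : p ∈ Finset.Icc 1 p := Finset.mem_Icc.2 ⟨hp, le_rfl⟩
      have hj' : 1 ∈ Finset.Icc 1 p := Finset.mem_Icc.2 ⟨le_rfl, hp⟩
      have h1 := hfv (i + 1) (by omega) hi.le p hp (by rw [if_pos hi])
      rw [hgout (i + 1) (by omega) hi, hflux i (by omega) p hj, hflux (i + 1) hi 1 hj'] at h1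
      have h2 := hbal _ (hgI i (by omega) p hj) _ (hgI (i + 1) hi 1 hj')
      simp only [hGdef]
      linarith
  have hwle : ∀ t, w t ≤ max βm⁻¹ βp⁻¹ := fun t => by
    simp only [hw, betaPW]; split_ifs <;> simp
  have hlew : ∀ t, min βm⁻¹ βp⁻¹ ≤ w t := fun t => by
    simp only [hw, betaPW]; split_ifs <;> simp
  have hw0 : ∀ t, 0 ≤ w t := fun t => (inv_pos.2 (hβpos t)).le
  have hsys : FluxSystem p N γ c (min βm⁻¹ βp⁻¹) (max βm⁻¹ βp⁻¹) a b hm ε (G 0 1) x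
      (fun i => g (i + 1)) (fun i => A (i + 1)) w e v P (fun i => T i - Q i) :=
    { left := hx0
      right := hxN
      lt_succ := hx
      length_le := hlen'
      weight_integrable := hwint a b
      le_weight := hlew
      weight_le := hwle
      node_mem := fun i hi j hj => Ioo_subset_Icc_self (hgmem i hi j hj).1
      weights_nonneg := fun i hi j hj => (hA (i + 1) (Finset.mem_Icc.2 ⟨by omega, hi⟩) j hj).le
      quad := fun i hi F hF => by
        have := hquad (i + 1) (Finset.mem_Icc.2 ⟨by omega, hi⟩) F hF
        rw [Nat.add_sub_cancel] at this
        rw [this]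
        exact intervalIntegral.integral_congr fun t _ => by
          simp only [hw]; rw [div_eq_mul_inv, mul_comm]
      continuousOn := hec
      eq_zero_left := by simp only [he]; rw [hu.2.1, huT.2.1, sub_zero]
      eq_zero_right := by simp only [he]; rw [hu.2.2.1, huT.2.2.1, sub_zero]
      countable := hP
      hasDerivAt := hev
      integrable := hvint
      integrable_sq := hv2int
      degree_le := fun i hi =>
        (Polynomial.natDegree_sub_le_of_le (hT i hi).1 (hQ i hi).1).trans (max_self _).le
      approx := fun i hi t ht => by
        have h1 := hvi i hi t ht.1 (hPα t ht.2)
        have h2 : v t - w t * (T i - Q i).eval t = w t * (q 0 t - (T i).eval t) := by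
          rw [h1, Polynomial.eval_sub]; ring
        rw [h2, mul_pow]
        refine mul_le_mul (pow_le_pow_left₀ (hw0 t) (hwle t) 2) ?_ (sq_nonneg _) (sq_nonneg _)
        exact sq_le_sq' (abs_le.1 ((hT i hi).2 t (Ioo_subset_Icc_self ht.1))).1
          (abs_le.1 ((hT i hi).2 t (Ioo_subset_Icc_self ht.1))).2
      node := fun i hi j hj => by
        have h1 := hG i hi j hj
        have h2 := abs_le.1 ((hT i hi).2 _ (Ioo_subset_Icc_self (hgmem i hi j hj).1))
        rw [← h1]
        simp only [hGdef, hφ, Polynomial.eval_sub]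
        refine sq_le_sq' ?_ ?_ <;> linarith [h2.1, h2.2] }
  have hfin := hstab p N a b hm ε (G 0 1) x _ _ w e v P _ hba hm0 hmle hsys
  calc Real.sqrt (∫ t in a..b, v t ^ 2) ≤ Real.sqrt (C * ε ^ 2) := Real.sqrt_le_sqrt hfin
    _ = Real.sqrt C * ε := by rw [Real.sqrt_mul hC.le, Real.sqrt_sq hε0]
    _ = Real.sqrt C * max βm βp * hm ^ p * W := by rw [hε]; ring
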